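/- Let 𝒢 be an ultragraph with at least one edge, 𝔽 the free group on 𝒢¹, and R a nonzero unital commutative ring. Then L_R(𝒢) is epsilon-strongly 𝔽-graded with respect to the grading {L_R(𝒢)_g}_{g∈𝔽} if and only if L_R(𝒢) is a unital ring. -/

import Mathlib

/-- An ultragraph: a source map `src : E → V` and a range map assigning to each
edge a nonempty set of vertices. -/
structure Ultragraph (V : Type) (E : Type) : Type where
  src : E → V
  rng : E → Set V
  rng_nonempty : ∀ e, (rng e).Nonempty

namespace Ultragraph

variable {V E : Type}

/-- A finite path: a (possibly empty) list of edges with compatible transitions. -/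
def IsPath (G : Ultragraph V E) (es : List E) : Prop :=
  es.Chain' fun e f => G.src f ∈ G.rng e

/-- An infinite path. -/
def IsInfinitePath (G : Ultragraph V E) (p : ℕ → E) : Prop :=
  ∀ i : ℕ, G.src (p (i + 1)) ∈ G.rng (p i)

/-- Condition (Y). -/
def ConditionY (G : Ultragraph V E) : Prop :=
  ∀ p : ℕ → E, G.IsInfinitePath p →
    ∃ (k : ℕ) (α : List E) (hα : α ≠ []),
      α.length = k + 1 ∧ G.IsPath α ∧ G.src (p k) ∈ G.rng (α.getLast hα)

/-- The collection 𝒢⁰ of generalized vertices: the smallest collection of subsets of `V`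
containing the singletons and the ranges of edges, closed under finite unions and finite
intersections (the empty set is included for convenience; `p_∅ = 0`). -/
inductive InG0 (G : Ultragraph V E) : Set V → Prop
  | vertex (v : V) : InG0 G {v}
  | range (e : E) : InG0 G (G.rng e)
  | union {A B : Set V} : InG0 G A → InG0 G B → InG0 G (A ∪ B)
  | inter {A B : Set V} : InG0 G A → InG0 G B → InG0 G (A ∩ B)

/-- Generators of the Leavitt path algebra. -/
inductive LPAGen (G : Ultragraph V E) : Type
  | edge : E → LPAGen G
  | star : E → LPAGen G
  | proj : (A : Set V) → G.InG0 A → LPAGen G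

/-- The directed graph `E_𝒢` associated to an ultragraph, viewed again as an ultragraph
whose edge ranges are singletons. -/
def toGraph (G : Ultragraph V E) : Ultragraph V {q : E × V // q.2 ∈ G.rng q.1} where
  src q := G.src q.1.1
  rng q := {q.1.2}
  rng_nonempty q := ⟨q.1.2, rfl⟩

variable (R : Type) [CommRing R] (G : Ultragraph V E)

/-- The free `R`-algebra on the generators. -/
abbrev FA := FreeAlgebra R (LPAGen G)

/-- The generator `g` inside the free algebra. -/
def X (g : LPAGen G) : FA R G := FreeAlgebra.ι R g

/-- The defining relations of the Leavitt path algebra of an ultragraph. -/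
inductive LeavittRel : FA R G → FA R G → Prop
  | proj_empty (h : G.InG0 ∅) : LeavittRel (X R G (.proj ∅ h)) 0
  | proj_mul (A B : Set V) (hA : G.InG0 A) (hB : G.InG0 B) :
      LeavittRel (X R G (.proj A hA) * X R G (.proj B hB))
        (X R G (.proj (A ∩ B) (hA.inter hB)))
  | proj_union (A B : Set V) (hA : G.InG0 A) (hB : G.InG0 B) :
      LeavittRel (X R G (.proj (A ∪ B) (hA.union hB)))
        (X R G (.proj A hA) + X R G (.proj B hB) - X R G (.proj (A ∩ B) (hA.inter hB)))
  | src_mul (e : E) :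
      LeavittRel (X R G (.proj {G.src e} (InG0.vertex (G.src e))) * X R G (.edge e))
        (X R G (.edge e))
  | mul_rng (e : E) :
      LeavittRel (X R G (.edge e) * X R G (.proj (G.rng e) (InG0.range e)))
        (X R G (.edge e))
  | rng_mul_star (e : E) :
      LeavittRel (X R G (.proj (G.rng e) (InG0.range e)) * X R G (.star e))
        (X R G (.star e))
  | star_mul_src (e : E) :
      LeavittRel (X R G (.star e) * X R G (.proj {G.src e} (InG0.vertex (G.src e))))
        (X R G (.star e))
  | star_mul_same (e : E) :
      LeavittRel (X R G (.star e) * X R G (.edge e))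
        (X R G (.proj (G.rng e) (InG0.range e)))
  | star_mul_ne (e f : E) (h : e ≠ f) :
      LeavittRel (X R G (.star e) * X R G (.edge f)) 0
  | ck (v : V) (hfin : {e : E | G.src e = v}.Finite) (hne : {e : E | G.src e = v}.Nonempty) :
      LeavittRel (X R G (.proj {v} (InG0.vertex v)))
        (∑ e ∈ hfin.toFinset, X R G (.edge e) * X R G (.star e))

/-- The (unital) quotient of the free algebra by the Leavitt relations; the Leavitt
path algebra `L_R(𝒢)` sits inside it as the non-unital subalgebra generated by the
generators. -/
abbrev LPABig := RingQuot (LeavittRel R G)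

/-- The image of a generator in the quotient. -/
def gen (g : LPAGen G) : LPABig R G := RingQuot.mkAlgHom R (LeavittRel R G) (X R G g)

/-- `s_e`. -/
def sgen (e : E) : LPABig R G := gen R G (.edge e)

/-- `s_e^*`. -/
def tgen (e : E) : LPABig R G := gen R G (.star e)

/-- `p_A`. -/
def pgen (A : Set V) (hA : G.InG0 A) : LPABig R G := gen R G (.proj A hA)

/-- `s_α` for a finite path `α` (the empty product is `1` in the ambient algebra). -/
def sPath (es : List E) : LPABig R G := (es.map (sgen R G)).prod

/-- `s_β^*` for a finite path `β`. -/
def tPath (es : List E) : LPABig R G := (es.reverse.map (tgen R G)).prod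

/-- The monomial `s_α p_A s_β^*`. -/
def mono (α : List E) (A : Set V) (hA : G.InG0 A) (β : List E) : LPABig R G :=
  sPath R G α * pgen R G A hA * tPath R G β

/-- The `m`-th component of the canonical `ℤ`-grading: all finite `R`-linear combinations
of monomials `s_α p_A s_β^*` with `|α| - |β| = m`. -/
def zComp (m : ℤ) : AddSubgroup (LPABig R G) :=
  AddSubgroup.closure {x | ∃ (l : R) (α β : List E) (A : Set V) (hA : G.InG0 A),
    G.IsPath α ∧ G.IsPath β ∧ (α.length : ℤ) - (β.length : ℤ) = m ∧
    x = l • mono R G α A hA β}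

/-- The element of the free group on the edges determined by a finite path. -/
def pathWord (es : List E) : FreeGroup E := (es.map FreeGroup.of).prod

/-- The `g`-th component of the free-group grading: all finite `R`-linear combinations
of monomials `s_α p_A s_β^*` with `α β⁻¹ = g` in the free group on the edges. -/
def fComp (g : FreeGroup E) : AddSubgroup (LPABig R G) :=
  AddSubgroup.closure {x | ∃ (l : R) (α β : List E) (A : Set V) (hA : G.InG0 A),
    G.IsPath α ∧ G.IsPath β ∧ pathWord α * (pathWord β)⁻¹ = g ∧
    x = l • mono R G α A hA β}

/-- The set of generators inside the quotient. -/
def genSet : Set (LPABig R G) := Set.range (gen R G)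

/-- The Leavitt path algebra `L_R(𝒢)`: the non-unital subalgebra of the quotient
generated by the images of the generators. -/
def LPA : NonUnitalSubalgebra R (LPABig R G) := NonUnitalAlgebra.adjoin R (genSet R G)

/-- `s_e` as an element of `L_R(𝒢)`. -/
def sEl (e : E) : LPA R G :=
  ⟨sgen R G e, NonUnitalAlgebra.subset_adjoin R ⟨LPAGen.edge e, rfl⟩⟩

/-- `s_e^*` as an element of `L_R(𝒢)`. -/
def tEl (e : E) : LPA R G :=
  ⟨tgen R G e, NonUnitalAlgebra.subset_adjoin R ⟨LPAGen.star e, rfl⟩⟩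

/-- `p_A` as an element of `L_R(𝒢)`. -/
def pEl (A : Set V) (hA : G.InG0 A) : LPA R G :=
  ⟨pgen R G A hA, NonUnitalAlgebra.subset_adjoin R ⟨LPAGen.proj A hA, rfl⟩⟩

end Ultragraph

/-- The additive span of the set of products `{a b : a ∈ S, b ∈ T}`. -/
def mulSpan {A : Type} [AddGroup A] [Mul A] (S T : AddSubgroup A) : AddSubgroup A :=
  AddSubgroup.closure {x | ∃ a ∈ S, ∃ b ∈ T, x = a * b}

namespace Ultragraph

variable {V E : Type} {G : Ultragraph V E}

section Relations

variable {R : Type} [CommRing R]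

lemma mkAlgHom_eq_of_rel {x y : FA R G} (h : LeavittRel R G x y) :
    RingQuot.mkAlgHom R (LeavittRel R G) x = RingQuot.mkAlgHom R (LeavittRel R G) y :=
  RingQuot.mkAlgHom_rel R h

lemma pgen_mul_pgen {A B : Set V} (hA : G.InG0 A) (hB : G.InG0 B) :
    pgen R G A hA * pgen R G B hB = pgen R G (A ∩ B) (hA.inter hB) := by
  simpa [pgen, sgen, tgen, gen] using mkAlgHom_eq_of_rel (LeavittRel.proj_mul (R := R) A B hA hB)

lemma pgen_congr {A B : Set V} (h : A = B) (hA : G.InG0 A) (hB : G.InG0 B) :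
    pgen R G A hA = pgen R G B hB := by
  subst h; rfl

lemma pgen_mul_pgen_of_subset {A B : Set V} (hA : G.InG0 A) (hB : G.InG0 B) (h : B ⊆ A) :
    pgen R G A hA * pgen R G B hB = pgen R G B hB := by
  rw [pgen_mul_pgen]
  exact pgen_congr (Set.inter_eq_right.mpr h) _ _

lemma commute_pgen {A B : Set V} (hA : G.InG0 A) (hB : G.InG0 B) :
    Commute (pgen R G A hA) (pgen R G B hB) := by
  rw [Commute, SemiconjBy, pgen_mul_pgen, pgen_mul_pgen]
  exact pgen_congr (Set.inter_comm A B) _ _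

lemma pgen_src_mul_sgen (e : E) :
    pgen R G {G.src e} (.vertex (G.src e)) * sgen R G e = sgen R G e := by
  simpa [pgen, sgen, tgen, gen] using mkAlgHom_eq_of_rel (LeavittRel.src_mul (R := R) e)

lemma sgen_mul_pgen_rng (e : E) :
    sgen R G e * pgen R G (G.rng e) (.range e) = sgen R G e := by
  simpa [pgen, sgen, tgen, gen] using mkAlgHom_eq_of_rel (LeavittRel.mul_rng (R := R) e)

lemma pgen_rng_mul_tgen (e : E) :
    pgen R G (G.rng e) (.range e) * tgen R G e = tgen R G e := by
  simpa [pgen, sgen, tgen, gen] using mkAlgHom_eq_of_rel (LeavittRel.rng_mul_star (R := R) e)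

lemma tgen_mul_pgen_src (e : E) :
    tgen R G e * pgen R G {G.src e} (.vertex (G.src e)) = tgen R G e := by
  simpa [pgen, sgen, tgen, gen] using mkAlgHom_eq_of_rel (LeavittRel.star_mul_src (R := R) e)

lemma tgen_mul_sgen_self (e : E) :
    tgen R G e * sgen R G e = pgen R G (G.rng e) (.range e) := by
  simpa [pgen, sgen, tgen, gen] using mkAlgHom_eq_of_rel (LeavittRel.star_mul_same (R := R) e)

lemma pgen_mul_sgen {A : Set V} (hA : G.InG0 A) {e : E} (h : G.src e ∈ A) :
    pgen R G A hA * sgen R G e = sgen R G e := by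
  rw [← pgen_src_mul_sgen, ← mul_assoc,
    pgen_mul_pgen_of_subset hA (.vertex _) (Set.singleton_subset_iff.mpr h)]

lemma tgen_mul_pgen {A : Set V} (hA : G.InG0 A) {e : E} (h : G.src e ∈ A) :
    tgen R G e * pgen R G A hA = tgen R G e := by
  rw [← tgen_mul_pgen_src, mul_assoc, ← (commute_pgen hA (.vertex _)).eq,
    pgen_mul_pgen_of_subset hA (.vertex _) (Set.singleton_subset_iff.mpr h)]

end Relations

section Paths

variable (R : Type) [CommRing R]

@[simp] lemma sPath_nil : sPath R G [] = 1 := rfl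

@[simp] lemma tPath_nil : tPath R G [] = 1 := rfl

@[simp] lemma sPath_cons (e : E) (α : List E) :
    sPath R G (e :: α) = sgen R G e * sPath R G α := by
  simp [sPath]

@[simp] lemma tPath_cons (e : E) (α : List E) :
    tPath R G (e :: α) = tPath R G α * tgen R G e := by
  simp [tPath]

lemma sPath_append (α β : List E) : sPath R G (α ++ β) = sPath R G α * sPath R G β := by
  simp [sPath]

lemma tPath_append (α β : List E) : tPath R G (α ++ β) = tPath R G β * tPath R G α := by
  simp [tPath]

variable {R}

lemma gen_mem_LPA (g : LPAGen G) : gen R G g ∈ LPA R G :=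
  NonUnitalAlgebra.subset_adjoin R ⟨g, rfl⟩

lemma pgen_mem_LPA {A : Set V} (hA : G.InG0 A) : pgen R G A hA ∈ LPA R G :=
  gen_mem_LPA _

lemma sPath_mul_mem_LPA (α : List E) {x : LPABig R G} (hx : x ∈ LPA R G) :
    sPath R G α * x ∈ LPA R G := by
  induction α with
  | nil => simpa using hx
  | cons e α ih =>
    rw [sPath_cons, mul_assoc]
    exact mul_mem (gen_mem_LPA _) ih

lemma mul_tPath_mem_LPA (α : List E) {x : LPABig R G} (hx : x ∈ LPA R G) :
    x * tPath R G α ∈ LPA R G := by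
  induction α with
  | nil => simpa using hx
  | cons e α ih =>
    rw [tPath_cons, ← mul_assoc]
    exact mul_mem ih (gen_mem_LPA _)

lemma mono_mem_LPA (α : List E) {A : Set V} (hA : G.InG0 A) (β : List E) :
    mono R G α A hA β ∈ LPA R G :=
  mul_tPath_mem_LPA β (sPath_mul_mem_LPA α (pgen_mem_LPA hA))

lemma fComp_le_LPA {g : FreeGroup E} {x : LPABig R G} (hx : x ∈ fComp R G g) :
    x ∈ LPA R G := by
  induction hx using AddSubgroup.closure_induction with
  | mem x hx =>
    obtain ⟨l, α, β, A, hA, -, -, -, rfl⟩ := hx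
    exact SMulMemClass.smul_mem l (mono_mem_LPA α hA β)
  | zero => exact zero_mem _
  | add x y _ _ hx hy => exact add_mem hx hy
  | neg x _ hx => exact neg_mem hx

lemma mono_mem_fComp {g : FreeGroup E} {α β : List E} {A : Set V} (hA : G.InG0 A)
    (hα : G.IsPath α) (hβ : G.IsPath β) (hg : pathWord α * (pathWord β)⁻¹ = g) :
    mono R G α A hA β ∈ fComp R G g :=
  AddSubgroup.subset_closure ⟨1, α, β, A, hA, hα, hβ, hg, (one_smul R _).symm⟩

lemma pgen_mem_fComp_one {A : Set V} (hA : G.InG0 A) : pgen R G A hA ∈ fComp R G 1 := by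
  have h := mono_mem_fComp (R := R) (g := 1) (α := []) (β := []) hA
    List.isChain_nil List.isChain_nil (by simp)
  simpa [mono] using h

lemma IsPath.of_append_left {α γ : List E} (h : G.IsPath (α ++ γ)) : G.IsPath α :=
  (List.isChain_append.mp h).1

lemma IsPath.src_mem_rng {α γ : List E} {e f : E} (h : G.IsPath (α ++ [e] ++ f :: γ)) :
    G.src f ∈ G.rng e := by
  have h' := (List.isChain_append.mp h).2.2
  simpa using h'

end Paths

section PathRange

/-- The range of a path, where the empty path is given the range `A`. -/
def pathRange (G : Ultragraph V E) (A : Set V) (α : List E) : Set V :=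
  (α.getLast?.map G.rng).getD A

@[simp] lemma pathRange_concat (A : Set V) (α : List E) (e : E) :
    G.pathRange A (α ++ [e]) = G.rng e := by
  simp [pathRange]

lemma inG0_pathRange {A : Set V} (hA : G.InG0 A) (α : List E) :
    G.InG0 (G.pathRange A α) := by
  induction α using List.reverseRecOn with
  | nil => exact hA
  | append_singleton α e => simpa using InG0.range e

variable (R : Type) [CommRing R]

/-- The projection onto the range of a path, where the empty path is given the range `A`. -/
def pathProj {A : Set V} (hA : G.InG0 A) (α : List E) : LPABig R G :=
  pgen R G (G.pathRange A α) (inG0_pathRange hA α)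

variable {R}

lemma pathProj_nil {A : Set V} (hA : G.InG0 A) : pathProj R hA [] = pgen R G A hA := rfl

lemma pathProj_concat {A : Set V} (hA : G.InG0 A) (α : List E) (e : E) :
    pathProj R hA (α ++ [e]) = pgen R G (G.rng e) (.range e) :=
  pgen_congr (pathRange_concat A α e) _ _

lemma pathProj_mul_self {A : Set V} (hA : G.InG0 A) (α : List E) :
    pathProj R hA α * pathProj R hA α = pathProj R hA α :=
  pgen_mul_pgen_of_subset _ _ subset_rfl

lemma commute_pathProj_pgen {A B : Set V} (hA : G.InG0 A) (α : List E) (hB : G.InG0 B) :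
    Commute (pathProj R hA α) (pgen R G B hB) :=
  commute_pgen _ _

lemma commute_pathProj {A : Set V} (hA : G.InG0 A) (α β : List E) :
    Commute (pathProj R hA α) (pathProj R hA β) :=
  commute_pgen _ _

lemma tPath_mul_sPath_concat {α : List E} {e : E} (h : G.IsPath (α ++ [e])) :
    tPath R G (α ++ [e]) * sPath R G (α ++ [e]) = pgen R G (G.rng e) (.range e) := by
  induction α with
  | nil => simp [tgen_mul_sgen_self]
  | cons f α ih =>
    have hc : G.IsPath (α ++ [e]) := (List.isChain_cons.mp h).2
    have hs : pgen R G (G.rng f) (.range f) * sPath R G (α ++ [e]) = sPath R G (α ++ [e]) := by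
      have hh := (List.isChain_cons.mp h).1
      rcases α with _ | ⟨f', α⟩
      · simpa using pgen_mul_sgen (InG0.range f) (by simpa using hh)
      · rw [List.cons_append, sPath_cons, ← mul_assoc,
          pgen_mul_sgen (InG0.range f) (by simpa using hh)]
    rw [List.cons_append, tPath_cons, sPath_cons, mul_assoc, ← mul_assoc (tgen R G f),
      tgen_mul_sgen_self, hs, ih hc]

lemma sPath_concat_mul_pgen_rng (α : List E) (e : E) :
    sPath R G (α ++ [e]) * pgen R G (G.rng e) (.range e) = sPath R G (α ++ [e]) := by
  simp [sPath_append, mul_assoc, sgen_mul_pgen_rng]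

lemma pgen_rng_mul_tPath_concat (α : List E) (e : E) :
    pgen R G (G.rng e) (.range e) * tPath R G (α ++ [e]) = tPath R G (α ++ [e]) := by
  simp [tPath_append, ← mul_assoc, pgen_rng_mul_tgen]

end PathRange

section Unit

variable {R : Type} [CommRing R]

/-- `p_A` is a two-sided identity of `L_R(𝒢)`. -/
def IsUnitProj (R : Type) [CommRing R] {A : Set V} (hA : G.InG0 A) : Prop :=
  ∀ x ∈ LPA R G, pgen R G A hA * x = x ∧ x * pgen R G A hA = x

variable {A : Set V} {hA : G.InG0 A}

lemma pathProj_mul_tPath_mul_sPath {α : List E} (hα : G.IsPath α) :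
    pathProj R hA α * (tPath R G α * sPath R G α) = pathProj R hA α := by
  rcases List.eq_nil_or_concat' α with rfl | ⟨α, e, rfl⟩
  · simp
  · rw [tPath_mul_sPath_concat hα, ← pathProj_concat hA α e, pathProj_mul_self]

lemma tPath_mul_sPath_mul_pathProj {α : List E} (hα : G.IsPath α) :
    tPath R G α * sPath R G α * pathProj R hA α = pathProj R hA α := by
  rcases List.eq_nil_or_concat' α with rfl | ⟨α, e, rfl⟩
  · simp
  · rw [tPath_mul_sPath_concat hα, ← pathProj_concat hA α e, pathProj_mul_self]

lemma IsUnitProj.sPath_mul_pathProj_mul (hu : IsUnitProj R hA) (α : List E)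
    {x : LPABig R G} (hx : x ∈ LPA R G) :
    sPath R G α * (pathProj R hA α * x) = sPath R G α * x := by
  rcases List.eq_nil_or_concat' α with rfl | ⟨α, e, rfl⟩
  · rw [pathProj_nil, (hu x hx).1]
  · rw [pathProj_concat, ← mul_assoc, sPath_concat_mul_pgen_rng]

lemma IsUnitProj.mul_pathProj_mul_tPath (hu : IsUnitProj R hA) (α : List E)
    {x : LPABig R G} (hx : x ∈ LPA R G) :
    x * pathProj R hA α * tPath R G α = x * tPath R G α := by
  rcases List.eq_nil_or_concat' α with rfl | ⟨α, e, rfl⟩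
  · rw [pathProj_nil, (hu x hx).2]
  · rw [pathProj_concat, mul_assoc, pgen_rng_mul_tPath_concat]

lemma IsUnitProj.pathProj_mul_sgen (hu : IsUnitProj R hA) {α γ : List E} {e : E}
    (h : G.IsPath (α ++ e :: γ)) : pathProj R hA α * sgen R G e = sgen R G e := by
  rcases List.eq_nil_or_concat' α with rfl | ⟨α, f, rfl⟩
  · exact (hu _ (gen_mem_LPA _)).1
  · rw [pathProj_concat, pgen_mul_sgen _ h.src_mem_rng]

lemma IsUnitProj.tgen_mul_pathProj (hu : IsUnitProj R hA) {α γ : List E} {e : E}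
    (h : G.IsPath (α ++ e :: γ)) : tgen R G e * pathProj R hA α = tgen R G e := by
  rcases List.eq_nil_or_concat' α with rfl | ⟨α, f, rfl⟩
  · exact (hu _ (gen_mem_LPA _)).2
  · rw [pathProj_concat, tgen_mul_pgen _ h.src_mem_rng]

variable (R) in
/-- The local unit `s_α p_{r(α) ∩ r(β)} s_α^*`. -/
def epsElem {A : Set V} (hA : G.InG0 A) (α β : List E) : LPABig R G :=
  sPath R G α * (pathProj R hA α * pathProj R hA β) * tPath R G α

lemma IsUnitProj.epsElem_mul_mono (hu : IsUnitProj R hA) {α β γ : List E}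
    (hα : G.IsPath (α ++ γ)) (hβ : G.IsPath (β ++ γ)) {B : Set V} (hB : G.InG0 B) :
    epsElem R hA α β * mono R G (α ++ γ) B hB (β ++ γ) =
      mono R G (α ++ γ) B hB (β ++ γ) := by
  have key : epsElem R hA α β * mono R G (α ++ γ) B hB (β ++ γ) = sPath R G α *
      (pathProj R hA α * (pathProj R hA β * (sPath R G γ * pgen R G B hB * tPath R G γ))) *
        tPath R G β := by
    rw [epsElem, mono, sPath_append, tPath_append, (commute_pathProj hA α β).eq]
    have h := pathProj_mul_tPath_mul_sPath (R := R) (hA := hA) hα.of_append_left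
    calc _ = sPath R G α * (pathProj R hA β * (pathProj R hA α *
            (tPath R G α * sPath R G α)) * (sPath R G γ * pgen R G B hB * tPath R G γ)) *
            tPath R G β := by simp only [mul_assoc]
      _ = _ := by rw [h, ← (commute_pathProj hA α β).eq]; simp only [mul_assoc]
  rw [key, mono, sPath_append, tPath_append]
  rcases γ with _ | ⟨e, γ⟩
  · have hp := pgen_mem_LPA (R := R) hB
    have hm : pgen R G B hB * pathProj R hA β ∈ LPA R G := mul_mem hp (pgen_mem_LPA _)
    simp only [sPath_nil, tPath_nil, one_mul, mul_one]
    rw [(commute_pathProj_pgen hA β hB).eq, hu.sPath_mul_pathProj_mul α hm, ← mul_assoc,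
      hu.mul_pathProj_mul_tPath β (sPath_mul_mem_LPA α hp)]
  · have h1 := hu.pathProj_mul_sgen hα
    have h2 := hu.pathProj_mul_sgen hβ
    simp only [sPath_cons, ← mul_assoc]
    simp only [mul_assoc _ _ (sgen R G e), h1, h2]

lemma IsUnitProj.mono_mul_epsElem (hu : IsUnitProj R hA) {α β γ : List E}
    (hα : G.IsPath (α ++ γ)) (hβ : G.IsPath (β ++ γ)) {B : Set V} (hB : G.InG0 B) :
    mono R G (α ++ γ) B hB (β ++ γ) * epsElem R hA β α =
      mono R G (α ++ γ) B hB (β ++ γ) := by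
  have key : mono R G (α ++ γ) B hB (β ++ γ) * epsElem R hA β α = sPath R G α *
      ((sPath R G γ * pgen R G B hB * tPath R G γ) * pathProj R hA α * pathProj R hA β) *
        tPath R G β := by
    rw [epsElem, mono, sPath_append, tPath_append]
    have h := tPath_mul_sPath_mul_pathProj (R := R) (hA := hA) hβ.of_append_left
    calc _ = sPath R G α * ((sPath R G γ * pgen R G B hB * tPath R G γ) *
            (tPath R G β * sPath R G β * pathProj R hA β * pathProj R hA α)) *
            tPath R G β := by simp only [mul_assoc]
      _ = _ := by rw [h, (commute_pathProj hA β α).eq]; simp only [mul_assoc]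
  rw [key, mono, sPath_append, tPath_append]
  rcases γ with _ | ⟨e, γ⟩
  · have hp := pgen_mem_LPA (R := R) hB
    have hm : pgen R G B hB * pathProj R hA β ∈ LPA R G := mul_mem hp (pgen_mem_LPA _)
    simp only [sPath_nil, tPath_nil, one_mul, mul_one]
    rw [← (commute_pathProj_pgen hA α hB).eq, mul_assoc (pathProj R hA α),
      hu.sPath_mul_pathProj_mul α hm, ← mul_assoc,
      hu.mul_pathProj_mul_tPath β (sPath_mul_mem_LPA α hp)]
  · have h1 := hu.tgen_mul_pathProj hα
    have h2 := hu.tgen_mul_pathProj hβ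
    simp only [tPath_cons, mul_assoc]
    simp only [← mul_assoc (tgen R G e), h1, h2]

lemma epsElem_mem_mulSpan {α β : List E} (hα : G.IsPath α) (hβ : G.IsPath β)
    {g : FreeGroup E} (hg : pathWord α * (pathWord β)⁻¹ = g) :
    epsElem R hA α β ∈ mulSpan (fComp R G g) (fComp R G g⁻¹) := by
  have hI := (inG0_pathRange hA α).inter (inG0_pathRange hA β)
  refine AddSubgroup.subset_closure ⟨mono R G α _ hI β, mono_mem_fComp hI hα hβ hg,
    mono R G β _ hI α, mono_mem_fComp hI hβ hα (by rw [← hg]; group), ?_⟩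
  have hp : pgen R G _ hI = pathProj R hA α * pathProj R hA β := (pgen_mul_pgen _ _).symm
  have h := pathProj_mul_tPath_mul_sPath (R := R) (hA := hA) hβ
  rw [epsElem, mono, mono, hp]
  calc _ = sPath R G α * (pathProj R hA α * pathProj R hA β *
          (pathProj R hA α * pathProj R hA β)) * tPath R G α := by
        rw [← hp, pgen_mul_pgen_of_subset _ _ subset_rfl]
    _ = sPath R G α * (pathProj R hA α * (pathProj R hA β * (tPath R G β * sPath R G β)) *
          (pathProj R hA α * pathProj R hA β)) * tPath R G α := by rw [h]
    _ = _ := by simp only [mul_assoc]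

lemma exists_pgen_mul_eq_self [Nonempty E] {x : LPABig R G} (hx : x ∈ LPA R G) :
    ∃ (A : Set V) (hA : G.InG0 A), pgen R G A hA * x = x := by
  induction hx using NonUnitalAlgebra.adjoin_induction with
  | mem x hx =>
    obtain ⟨g, rfl⟩ := hx
    cases g with
    | edge e => exact ⟨_, _, pgen_src_mul_sgen e⟩
    | star e => exact ⟨_, _, pgen_rng_mul_tgen e⟩
    | proj A hA => exact ⟨A, hA, pgen_mul_pgen_of_subset hA hA subset_rfl⟩
  | add x y _ _ hx hy =>
    obtain ⟨A, hA, hx⟩ := hx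
    obtain ⟨B, hB, hy⟩ := hy
    refine ⟨A ∪ B, hA.union hB, ?_⟩
    rw [mul_add, ← hx, ← hy, ← mul_assoc, ← mul_assoc,
      pgen_mul_pgen_of_subset _ _ Set.subset_union_left,
      pgen_mul_pgen_of_subset _ _ Set.subset_union_right]
  | zero => exact ⟨_, .range (Classical.arbitrary E), mul_zero _⟩
  | mul x y _ _ hx _ =>
    obtain ⟨A, hA, hx⟩ := hx
    exact ⟨A, hA, by rw [← mul_assoc, hx]⟩
  | smul r x _ hx =>
    obtain ⟨A, hA, hx⟩ := hx
    exact ⟨A, hA, by rw [mul_smul_comm, hx]⟩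

lemma exists_isUnitProj [Nonempty E] {u : LPABig R G} (hu : u ∈ LPA R G)
    (h : ∀ x ∈ LPA R G, u * x = x ∧ x * u = x) :
    ∃ (A : Set V) (hA : G.InG0 A), IsUnitProj R hA := by
  obtain ⟨A, hA, hAu⟩ := exists_pgen_mul_eq_self hu
  rw [(h _ (pgen_mem_LPA hA)).2] at hAu
  exact ⟨A, hA, by rwa [IsUnitProj, hAu]⟩

lemma isIdentity_of_fComp_one {u : LPABig R G}
    (hu : ∀ t ∈ fComp R G 1, u * t = t ∧ t * u = t) {x : LPABig R G} (hx : x ∈ LPA R G) :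
    u * x = x ∧ x * u = x := by
  induction hx using NonUnitalAlgebra.adjoin_induction with
  | mem x hx =>
    obtain ⟨g, rfl⟩ := hx
    cases g with
    | edge e =>
      change u * sgen R G e = sgen R G e ∧ sgen R G e * u = sgen R G e
      constructor
      · rw [← pgen_src_mul_sgen, ← mul_assoc, (hu _ (pgen_mem_fComp_one _)).1]
      · rw [← sgen_mul_pgen_rng, mul_assoc, (hu _ (pgen_mem_fComp_one _)).2]
    | star e =>
      change u * tgen R G e = tgen R G e ∧ tgen R G e * u = tgen R G e
      constructor
      · rw [← pgen_rng_mul_tgen, ← mul_assoc, (hu _ (pgen_mem_fComp_one _)).1]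
      · rw [← tgen_mul_pgen_src, mul_assoc, (hu _ (pgen_mem_fComp_one _)).2]
    | proj A hA => exact hu _ (pgen_mem_fComp_one hA)
  | add x y _ _ hx hy => simp only [mul_add, add_mul, hx, hy, and_self]
  | zero => simp
  | mul x y _ _ hx hy => exact ⟨by rw [← mul_assoc, hx.1], by rw [mul_assoc, hy.2]⟩
  | smul r x _ hx => simp only [mul_smul_comm, smul_mul_assoc, hx, and_self]

end Unit

section FreeGroupWord

/-- Two lists of edges which do not end with the same edge. -/
def NoCommonLast (α β : List E) : Prop :=
  ∀ a ∈ α.getLast?, ∀ b ∈ β.getLast?, a ≠ b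

lemma NoCommonLast.symm {α β : List E} (h : NoCommonLast α β) : NoCommonLast β α :=
  fun a ha b hb => (h b hb a ha).symm

lemma exists_noCommonLast (α β : List E) :
    ∃ α' β' γ : List E, α = α' ++ γ ∧ β = β' ++ γ ∧ NoCommonLast α' β' := by
  induction α using List.reverseRecOn generalizing β with
  | nil => exact ⟨[], β, [], by simp [NoCommonLast]⟩
  | append_singleton α a ih =>
    rcases List.eq_nil_or_concat' β with rfl | ⟨β, b, rfl⟩
    · exact ⟨α ++ [a], [], [], by simp [NoCommonLast]⟩
    · by_cases hab : a = b
      · subst hab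
        obtain ⟨α', β', γ, rfl, rfl, h⟩ := ih β
        exact ⟨α', β', γ ++ [a], by simp, by simp, h⟩
      · exact ⟨α ++ [a], β ++ [b], [], by simp, by simp, by simpa [NoCommonLast] using hab⟩

lemma pathWord_append (α β : List E) : pathWord (α ++ β) = pathWord α * pathWord β := by
  simp [pathWord]

lemma pathWord_eq_mk (α : List E) : pathWord α = FreeGroup.mk (α.map fun e => (e, true)) := by
  induction α with
  | nil => rfl
  | cons e α ih =>
    rw [← List.singleton_append, pathWord_append, ih, List.map_append, ← FreeGroup.mul_mk]
    simp [pathWord, FreeGroup.of]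

lemma pathWord_mul_inv_eq_mk (α β : List E) :
    pathWord α * (pathWord β)⁻¹ = FreeGroup.mk
      ((α.map fun e => (e, true)) ++ (β.reverse.map fun e => (e, false))) := by
  rw [pathWord_eq_mk, pathWord_eq_mk, FreeGroup.inv_mk, FreeGroup.mul_mk]
  simp [FreeGroup.invRev, Function.comp_def]

lemma isReduced_word {α β : List E} (h : NoCommonLast α β) :
    FreeGroup.IsReduced
      ((α.map fun e => (e, true)) ++ (β.reverse.map fun e => (e, false))) := by
  refine List.isChain_append.mpr ⟨?_, ?_, ?_⟩
  · rw [List.isChain_map]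
    exact (List.pairwise_of_forall fun _ _ _ => rfl).isChain
  · rw [List.isChain_map]
    exact (List.pairwise_of_forall fun _ _ _ => rfl).isChain
  · intro x hx y hy
    simp only [List.getLast?_map, List.head?_map, List.head?_reverse, Option.mem_def,
      Option.map_eq_some_iff] at hx hy
    obtain ⟨a, ha, rfl⟩ := hx
    obtain ⟨b, hb, rfl⟩ := hy
    exact fun hab => absurd hab (h a ha b hb)

lemma NoCommonLast.eq_of_pathWord_eq {α β α' β' : List E} (h : NoCommonLast α β)
    (h' : NoCommonLast α' β')
    (heq : pathWord α * (pathWord β)⁻¹ = pathWord α' * (pathWord β')⁻¹) :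
    α = α' ∧ β = β' := by
  classical
  have hw := congrArg FreeGroup.toWord heq
  rw [pathWord_mul_inv_eq_mk, pathWord_mul_inv_eq_mk, FreeGroup.toWord_mk, FreeGroup.toWord_mk,
    (isReduced_word h).reduce_eq, (isReduced_word h').reduce_eq] at hw
  have h1 := congrArg (fun l => (l.filter fun x => x.2).map Prod.fst) hw
  have h2 := congrArg (fun l => (l.filter fun x => !x.2).map Prod.fst) hw
  simp [List.filter_map, Function.comp_def] at h1 h2
  exact ⟨h1, h2⟩

end FreeGroupWord

section Eps

variable (R : Type) [CommRing R]

open Classical in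
/-- The local unit of the component of degree `g`. -/
noncomputable def eps {A : Set V} (hA : G.InG0 A) (g : FreeGroup E) : LPABig R G :=
  if h : ∃ p : List E × List E, G.IsPath p.1 ∧ G.IsPath p.2 ∧ NoCommonLast p.1 p.2 ∧
      pathWord p.1 * (pathWord p.2)⁻¹ = g then
    epsElem R hA h.choose.1 h.choose.2
  else 0

variable {R} {A : Set V} {hA : G.InG0 A}

lemma eps_mem_mulSpan (g : FreeGroup E) :
    eps R hA g ∈ mulSpan (fComp R G g) (fComp R G g⁻¹) := by
  unfold eps
  split_ifs with h
  · exact epsElem_mem_mulSpan h.choose_spec.1 h.choose_spec.2.1 h.choose_spec.2.2.2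
  · exact zero_mem _

lemma eps_eq {α β : List E} (hα : G.IsPath α) (hβ : G.IsPath β) (h : NoCommonLast α β)
    {g : FreeGroup E} (hg : pathWord α * (pathWord β)⁻¹ = g) :
    eps R hA g = epsElem R hA α β := by
  have hex : ∃ p : List E × List E, G.IsPath p.1 ∧ G.IsPath p.2 ∧ NoCommonLast p.1 p.2 ∧
      pathWord p.1 * (pathWord p.2)⁻¹ = g := ⟨(α, β), hα, hβ, h, hg⟩
  obtain ⟨h1, h2⟩ := hex.choose_spec.2.2.1.eq_of_pathWord_eq h
    (hex.choose_spec.2.2.2.trans hg.symm)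
  rw [eps, dif_pos hex, h1, h2]

lemma IsUnitProj.eps_mul_eq_self_and (hu : IsUnitProj R hA) {g : FreeGroup E} {t : LPABig R G}
    (ht : t ∈ fComp R G g) : eps R hA g * t = t ∧ t * eps R hA g⁻¹ = t := by
  induction ht using AddSubgroup.closure_induction with
  | mem t ht =>
    obtain ⟨l, α, β, B, hB, hα, hβ, hg, rfl⟩ := ht
    obtain ⟨α, β, γ, rfl, rfl, h⟩ := exists_noCommonLast α β
    have hg' : pathWord α * (pathWord β)⁻¹ = g := by
      rw [← hg, pathWord_append, pathWord_append]; group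
    rw [eps_eq hα.of_append_left hβ.of_append_left h hg',
      eps_eq hβ.of_append_left hα.of_append_left h.symm (by rw [← hg']; group),
      mul_smul_comm, smul_mul_assoc, hu.epsElem_mul_mono hα hβ, hu.mono_mul_epsElem hα hβ]
    exact ⟨rfl, rfl⟩
  | zero => simp
  | add x y _ _ hx hy => simp only [mul_add, add_mul, hx, hy, and_self]
  | neg x _ hx =>
    exact ⟨(mul_neg _ _).trans (congrArg _ hx.1), (neg_mul _ _).trans (congrArg _ hx.2)⟩

end Eps

end Ultragraph


open Ultragraph in
/-- `L_R(𝒢)` is epsilon-strongly graded by the free group on the edges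
iff `L_R(𝒢)` is a unital ring. -/
theorem epsilonStrongF_iff_unital {V E : Type} [Countable V] [Countable E]
    (G : Ultragraph V E) [Nonempty E] (R : Type) [CommRing R] [Nontrivial R] :
    (∃ eps : FreeGroup E → LPABig R G, ∀ g : FreeGroup E,
        eps g ∈ mulSpan (fComp R G g) (fComp R G g⁻¹) ∧
        ∀ t ∈ fComp R G g, eps g * t = t ∧ t * eps g⁻¹ = t) ↔
      (∃ u ∈ LPA R G, ∀ x ∈ LPA R G, u * x = x ∧ x * u = x) := by
  constructor
  · rintro ⟨eps, h⟩
    obtain ⟨hmem, hid⟩ := h 1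
    rw [inv_one] at hmem hid
    refine ⟨eps 1, ?_, fun x hx => isIdentity_of_fComp_one hid hx⟩
    refine (AddSubgroup.closure_le (K := (LPA R G).toNonUnitalSubring.toAddSubgroup)).mpr ?_ hmem
    rintro _ ⟨a, ha, b, hb, rfl⟩
    exact (LPA R G).mul_mem (fComp_le_LPA ha) (fComp_le_LPA hb)
  · rintro ⟨u, hu, h⟩
    obtain ⟨A, hA, hA'⟩ := exists_isUnitProj hu h
    exact ⟨eps R hA, fun g => ⟨eps_mem_mulSpan g, fun t ht => hA'.eps_mul_eq_self_and ht⟩⟩
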